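/- The shadowing property is generic in C_λ(I): there is a residual subset R of C_λ(I) such that every f ∈ R has the shadowing property, i.e., for every ε > 0 there exists δ > 0 such that every δ-pseudo orbit (y_n)_{n≥0} of f is ε-traced by some point x ∈ [0,1]. -/

import Mathlib

open MeasureTheory Set Metric Filter Topology

noncomputable section

/-- Lebesgue measure on the unit interval `[0,1]`, viewed as a measure on the subtype. -/
def lebI : Measure unitInterval := (volume : Measure ℝ).comap Subtype.val

/-- A continuous self-map of `[0,1]` preserves Lebesgue measure. -/
def MeasPres (f : C(unitInterval, unitInterval)) : Prop :=
  ∀ A : Set unitInterval, MeasurableSet A → lebI (f ⁻¹' A) = lebI A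

/-- The space `C_λ(I)` of continuous Lebesgue-measure-preserving maps of `[0,1]`. -/
def CLam : Set C(unitInterval, unitInterval) := {f | MeasPres f}

/-- `Fix(f,k) = {x : f^k x = x}`. -/
def FixSet {X : Type*} (f : X → X) (k : ℕ) : Set X := {x | f^[k] x = x}

/-- `Per(f,k) = {x : f^k x = x and f^i x ≠ x for 1 ≤ i < k}`. -/
def PerSet {X : Type*} (f : X → X) (k : ℕ) : Set X :=
  {x | f^[k] x = x ∧ ∀ i : ℕ, 1 ≤ i → i < k → f^[i] x ≠ x}

/-- `Per(f) = ⋃_{k ≥ 1} Fix(f,k)`, the set of all periodic points. -/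
def PerAll {X : Type*} (f : X → X) : Set X := ⋃ k ∈ {k : ℕ | 1 ≤ k}, FixSet f k

/-- A Cantor set: nonempty, compact, perfect and totally disconnected. -/
def IsCantorSet {X : Type*} [TopologicalSpace X] (C : Set X) : Prop :=
  C.Nonempty ∧ IsCompact C ∧ Perfect C ∧ IsTotallyDisconnected C

/-- `y` is a `δ`-pseudo orbit of `f`. -/
def IsPseudoOrbit (f : unitInterval → unitInterval) (δ : ℝ) (y : ℕ → unitInterval) : Prop :=
  ∀ n : ℕ, dist (f (y n)) (y (n + 1)) < δ

/-- The point `x` `ε`-traces the sequence `y`. -/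
def Traces (f : unitInterval → unitInterval) (ε : ℝ) (x : unitInterval) (y : ℕ → unitInterval) :
    Prop :=
  ∀ n : ℕ, dist (f^[n] x) (y n) < ε

/-- The shadowing property. -/
def Shadowing (f : unitInterval → unitInterval) : Prop :=
  ∀ ε > (0 : ℝ), ∃ δ > (0 : ℝ), ∀ y : ℕ → unitInterval,
    IsPseudoOrbit f δ y → ∃ x : unitInterval, Traces f ε x y

theorem lebI_apply (S : Set unitInterval) : lebI S = volume (Subtype.val '' S) :=
  comap_subtype_coe_apply measurableSet_Icc _ S

theorem volume_eq_two_mul_of_neg_mem {l : ℝ} (hl : 0 < l) [Fact (0 < 2 * l)]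
    {B : Set (AddCircle (2 * l))} (hB : MeasurableSet B) (hneg : ∀ x ∈ B, -x ∈ B) :
    volume B = 2 * volume {x : ℝ | x ∈ Icc 0 l ∧ (x : AddCircle (2 * l)) ∈ B} := by
  set P : Set ℝ := {x : ℝ | (x : AddCircle (2 * l)) ∈ B} with hP
  have hPm : MeasurableSet P := measurableSet_preimage AddCircle.measurable_mk' hB
  have h1 : volume B = volume (P ∩ Ioc (-l) l) := by
    have := AddCircle.add_projection_respects_measure (2 * l) (-l) hB
    rw [this]
    congr 2
    ring_nf
  have hsym : volume (P ∩ Icc (-l) 0) = volume (P ∩ Icc 0 l) := by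
    have : P ∩ Icc (-l) 0 = Neg.neg ⁻¹' (P ∩ Icc 0 l) := by
      ext x
      simp only [mem_inter_iff, mem_Icc, mem_preimage, hP, mem_ofPred_eq]
      constructor
      · rintro ⟨hx, h1, h2⟩
        exact ⟨by simpa using hneg _ hx, by linarith, by linarith⟩
      · rintro ⟨hx, h1, h2⟩
        exact ⟨by simpa using hneg _ hx, by linarith, by linarith⟩
    rw [this, Measure.measure_preimage_neg]
  have h2 : P ∩ Ioc (-l) l = (P ∩ Ioc (-l) 0) ∪ (P ∩ Ioc 0 l) := by
    rw [← inter_union_distrib_left, Ioc_union_Ioc_eq_Ioc (by linarith) hl.le]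
  have hd : Disjoint (P ∩ Ioc (-l) 0) (P ∩ Ioc 0 l) :=
    (Ioc_disjoint_Ioc_of_le le_rfl).mono inter_subset_right inter_subset_right
  have hae : ∀ a b : ℝ, volume (P ∩ Ioc a b) = volume (P ∩ Icc a b) := fun a b =>
    measure_congr ((ae_eq_refl P).inter Ioc_ae_eq_Icc)
  rw [h1, h2, measure_union hd (hPm.inter measurableSet_Ioc), hae, hae, hsym, ← two_mul, inter_comm]
  rfl

/-- Folding `[0, l]` onto itself along `m` equal laps preserves Lebesgue measure. -/
theorem volume_norm_coe_mul_mem {l : ℝ} (hl : 0 < l) {m : ℕ} (hm : 1 < m) {A : Set ℝ}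
    (hA : MeasurableSet A) :
    volume {x : ℝ | x ∈ Icc 0 l ∧ ‖((m * x : ℝ) : AddCircle (2 * l))‖ ∈ A} =
      volume (Icc 0 l ∩ A) := by
  have : Fact (0 < 2 * l) := ⟨by linarith⟩
  set B : Set (AddCircle (2 * l)) := {θ | ‖θ‖ ∈ A} with hB
  have hBm : MeasurableSet B := measurable_norm hA
  have hT : MeasurePreserving (fun θ : AddCircle (2 * l) => m • θ) volume volume :=
    (AddCircle.ergodic_nsmul hm).toMeasurePreserving
  have h1 := volume_eq_two_mul_of_neg_mem hl hBm (fun x hx => by simpa [hB] using hx)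
  have h2 := volume_eq_two_mul_of_neg_mem hl (hT.measurable hBm)
    (fun x hx => by simpa [hB] using hx)
  rw [hT.measure_preimage hBm.nullMeasurableSet, h1] at h2
  have h3 := (ENNReal.mul_right_inj two_ne_zero (by norm_num)).1 h2
  have e1 : {x : ℝ | x ∈ Icc 0 l ∧ ‖((m * x : ℝ) : AddCircle (2 * l))‖ ∈ A} =
      {x : ℝ | x ∈ Icc 0 l ∧ (x : AddCircle (2 * l)) ∈
        (fun θ : AddCircle (2 * l) => m • θ) ⁻¹' B} := by
    ext x
    have : ((m * x : ℝ) : AddCircle (2 * l)) = m • (x : AddCircle (2 * l)) := by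
      rw [← nsmul_eq_mul, AddCircle.coe_nsmul]
    simp only [mem_ofPred_eq, mem_preimage, this, hB]
  have e2 : Icc 0 l ∩ A = {x : ℝ | x ∈ Icc 0 l ∧ (x : AddCircle (2 * l)) ∈ B} := by
    ext x
    simp only [mem_inter_iff, mem_ofPred_eq, hB]
    refine and_congr_right fun hx => ?_
    rw [(AddCircle.norm_coe_eq_abs_iff (2 * l) (by positivity)).2, abs_of_nonneg hx.1]
    rw [abs_of_nonneg hx.1, abs_of_pos (by linarith)]
    linarith [hx.2]
  rw [e1, e2, h3]

theorem MeasPres.comp {f g : C(unitInterval, unitInterval)} (hf : MeasPres f) (hg : MeasPres g) :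
    MeasPres (f.comp g) := fun A hA => by
  rw [ContinuousMap.coe_comp, preimage_comp, hg _ (f.continuous.measurable hA), hf _ hA]

/-- Zigzag map of `[p, q]` with `m` laps, extended by the identity. -/
def zigzag (p q : ℝ) (m : ℕ) (x : ℝ) : ℝ :=
  min x p + ‖((m * (max p (min q x) - p) : ℝ) : AddCircle (2 * (q - p)))‖ + max (x - q) 0

theorem continuous_zigzag (p q : ℝ) (m : ℕ) : Continuous (zigzag p q m) := by
  unfold zigzag
  have : Continuous fun x : ℝ => ((m * (max p (min q x) - p) : ℝ) : AddCircle (2 * (q - p))) :=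
    (AddCircle.continuous_mk' _).comp (by fun_prop)
  fun_prop

theorem zigzag_of_mem {p q : ℝ} (m : ℕ) {x : ℝ} (hx : x ∈ Icc p q) :
    zigzag p q m x = p + ‖((m * (x - p) : ℝ) : AddCircle (2 * (q - p)))‖ := by
  simp [zigzag, hx.1, hx.2]

theorem zigzag_mem {p q : ℝ} (hpq : p < q) (m : ℕ) {x : ℝ} (hx : x ∈ Icc p q) :
    zigzag p q m x ∈ Icc p q := by
  rw [zigzag_of_mem m hx]
  have h := AddCircle.norm_le_half_period (2 * (q - p))
    (x := ((m * (x - p) : ℝ) : AddCircle (2 * (q - p)))) (by linarith)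
  rw [abs_of_pos (by linarith)] at h
  constructor
  · linarith [norm_nonneg ((m * (x - p) : ℝ) : AddCircle (2 * (q - p)))]
  · linarith

theorem norm_coe_add_int_mul {l s : ℝ} (hs : s ∈ Icc 0 l) (k : ℤ) :
    ‖((s + k * (2 * l) : ℝ) : AddCircle (2 * l))‖ = s := by
  have h : ((s + k * (2 * l) : ℝ) : AddCircle (2 * l)) = (s : AddCircle (2 * l)) := by
    rw [← zsmul_eq_mul]
    simp
  rcases hs.1.eq_or_lt with rfl | h0
  · rw [h]; simp
  · rw [h, (AddCircle.norm_coe_eq_abs_iff (2 * l) (by linarith [hs.2])).2, abs_of_nonneg hs.1]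
    rw [abs_of_nonneg hs.1, abs_of_pos (by linarith [hs.2])]
    linarith [hs.2]

theorem zigzag_of_notMem {p q : ℝ} (hpq : p < q) (k : ℕ) {x : ℝ} (hx : x ≤ p ∨ q ≤ x) :
    zigzag p q (2 * k + 1) x = x := by
  rcases hx with hx | hx
  · simp [zigzag, hx, hx.trans hpq.le]
  · have h1 : max p (min q x) = q := by rw [min_eq_left hx, max_eq_right hpq.le]
    have h2 := norm_coe_add_int_mul (l := q - p) (s := q - p) ⟨by linarith, le_rfl⟩ k
    have h3 : (((2 * k + 1 : ℕ) : ℝ) * (q - p)) = q - p + (k : ℤ) * (2 * (q - p)) := by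
      push_cast; ring
    rw [zigzag, h1, h3, h2, min_eq_right (hpq.le.trans hx), max_eq_left (by linarith)]
    ring

theorem exists_zigzag_eq {p q : ℝ} (hpq : p < q) {m : ℕ} (hm : 0 < m) {s t w : ℝ} (hs : p ≤ s)
    (ht : t ≤ q) (hst : 2 * (q - p) ≤ m * (t - s)) (hw : w ∈ Icc p q) :
    ∃ u ∈ Icc s t, zigzag p q m u = w := by
  have hm' : (0 : ℝ) < m := by exact_mod_cast hm
  have hl : 0 < 2 * (q - p) := by linarith
  set k : ℤ := ⌈(m * (s - p) - (w - p)) / (2 * (q - p))⌉ with hk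
  have hk1 : m * (s - p) - (w - p) ≤ k * (2 * (q - p)) := by
    rw [← div_le_iff₀ hl]; exact Int.le_ceil _
  have hk2 : k * (2 * (q - p)) ≤ m * (s - p) - (w - p) + 2 * (q - p) := by
    have := (Int.ceil_lt_add_one ((m * (s - p) - (w - p)) / (2 * (q - p)))).le
    rw [← hk, ← sub_le_iff_le_add, le_div_iff₀ hl] at this
    linarith
  set u : ℝ := p + (w - p + k * (2 * (q - p))) / m with hu
  have hu' : m * (u - p) = w - p + k * (2 * (q - p)) := by
    rw [hu]; field_simp; ring
  have h1 : s ≤ u := by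
    refine le_of_mul_le_mul_left ?_ hm'
    linarith
  have h2 : u ≤ t := by
    refine le_of_mul_le_mul_left ?_ hm'
    linarith
  refine ⟨u, ⟨h1, h2⟩, ?_⟩
  rw [zigzag_of_mem m ⟨hs.trans h1, h2.trans ht⟩, hu', norm_coe_add_int_mul]
  · ring
  · exact ⟨by linarith [hw.1], by linarith [hw.2]⟩

theorem exists_measPres_zigzag {p q τ : ℝ} (hp : 0 ≤ p) (hpq : p < q) (hq : q ≤ 1) (hτ : 0 < τ) :
    ∃ z : C(unitInterval, unitInterval), MeasPres z ∧
      (∀ x : unitInterval, (x : ℝ) ≤ p ∨ q ≤ x → z x = x) ∧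
      (∀ x : unitInterval, (x : ℝ) ∈ Icc p q → (z x : ℝ) ∈ Icc p q) ∧
      ∀ s t : ℝ, p ≤ s → t ≤ q → τ ≤ t - s → ∀ w : unitInterval, (w : ℝ) ∈ Icc p q →
        ∃ u : unitInterval, (u : ℝ) ∈ Icc s t ∧ z u = w := by
  obtain ⟨k, hk⟩ := exists_nat_gt (2 * (q - p) / τ)
  have hk0 : 0 < k := by
    have : (0 : ℝ) < k := lt_of_le_of_lt (div_nonneg (by linarith) hτ.le) hk
    exact_mod_cast this
  rw [div_lt_iff₀ hτ] at hk
  have hmem : ∀ x : unitInterval, zigzag p q (2 * k + 1) x ∈ unitInterval := by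
    intro x
    by_cases hx : (x : ℝ) ∈ Icc p q
    · have := zigzag_mem hpq (2 * k + 1) hx
      exact ⟨hp.trans this.1, this.2.trans hq⟩
    · rw [zigzag_of_notMem hpq]
      · exact x.2
      · by_contra! h
        exact hx ⟨h.1.le, h.2.le⟩
  let z : C(unitInterval, unitInterval) :=
    ⟨fun x => ⟨zigzag p q (2 * k + 1) x, hmem x⟩,
      ((continuous_zigzag p q _).comp continuous_subtype_val).subtype_mk _⟩
  have hzv : ∀ x, (z x : ℝ) = zigzag p q (2 * k + 1) x := fun _ => rfl
  have hzid : ∀ x : unitInterval, (x : ℝ) ≤ p ∨ q ≤ x → z x = x := fun x hx =>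
    Subtype.ext (zigzag_of_notMem hpq k hx)
  have hzmem : ∀ x : unitInterval, (x : ℝ) ∈ Icc p q → (z x : ℝ) ∈ Icc p q := fun x hx =>
    zigzag_mem hpq _ hx
  refine ⟨z, ?_, hzid, hzmem, ?_⟩
  · intro A hA
    set J : Set unitInterval := {x | (x : ℝ) ∈ Icc p q} with hJ
    have hJm : MeasurableSet J := measurable_subtype_coe measurableSet_Icc
    have hout : z ⁻¹' A \ J = A \ J := by
      ext x
      simp only [Set.mem_sdiff, mem_preimage]
      refine and_congr_left fun hx => ?_
      rw [hzid x]
      by_contra! h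
      exact hx ⟨h.1.le, h.2.le⟩
    have hin : lebI (z ⁻¹' A ∩ J) = lebI (A ∩ J) := by
      set A' : Set ℝ := (fun y => p + y) ⁻¹' (Subtype.val '' A) with hA'
      have hA'm : MeasurableSet A' :=
        (measurable_const_add p) (measurableSet_Icc.subtype_image hA)
      have key := volume_norm_coe_mul_mem (l := q - p) (by linarith) (m := 2 * k + 1) (by omega) hA'm
      rw [lebI_apply, lebI_apply, ← measure_preimage_add volume p,
        ← measure_preimage_add volume p (Subtype.val '' (A ∩ J))]
      convert key using 2
      · ext x
        constructor
        · rintro ⟨y, ⟨hyA, hyJ⟩, hyx⟩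
          have hyx : (y : ℝ) = p + x := hyx
          have hyJ : (y : ℝ) ∈ Icc p q := hyJ
          refine ⟨⟨by linarith [hyJ.1], by linarith [hyJ.2]⟩, z y, hyA, ?_⟩
          rw [hzv, zigzag_of_mem _ hyJ, hyx]
          simp
        · rintro ⟨hx, y, hyA, hyx⟩
          have hx' : p + x ∈ Icc p q := ⟨by linarith [hx.1], by linarith [hx.2]⟩
          refine ⟨⟨p + x, hp.trans hx'.1, hx'.2.trans hq⟩, ⟨?_, hx'⟩, rfl⟩
          have : z ⟨p + x, hp.trans hx'.1, hx'.2.trans hq⟩ = y := by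
            apply Subtype.ext
            rw [hzv, zigzag_of_mem _ hx', hyx]
            simp
          rw [mem_preimage, this]
          exact hyA
      · ext x
        constructor
        · rintro ⟨y, ⟨hyA, hyJ⟩, hyx⟩
          have hyx : (y : ℝ) = p + x := hyx
          have hyJ : (y : ℝ) ∈ Icc p q := hyJ
          exact ⟨⟨by linarith [hyJ.1], by linarith [hyJ.2]⟩, y, hyA, hyx⟩
        · rintro ⟨hx, y, hyA, hyx⟩
          have hyx : (y : ℝ) = p + x := hyx
          refine ⟨y, ⟨hyA, ?_⟩, hyx⟩
          change (y : ℝ) ∈ Icc p q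
          exact ⟨by linarith [hx.1], by linarith [hx.2]⟩
    rw [← measure_inter_add_sdiff (z ⁻¹' A) hJm, hin, hout, measure_inter_add_sdiff A hJm]
  · intro s t hs ht hst w hw
    obtain ⟨u, hu, huw⟩ := exists_zigzag_eq hpq (m := 2 * k + 1) (by omega) hs ht
      (by push_cast; nlinarith) hw
    exact ⟨⟨u, hp.trans (hs.trans hu.1), (hu.2.trans ht).trans hq⟩, hu, Subtype.ext huw⟩

/-- Given a finite partition `b 0 < ⋯ < b N`, there is a measure-preserving map which maps every
subinterval of length at least `τ` of a partition interval onto that partition interval. -/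
theorem exists_measPres_zigzag_partition {b : ℕ → ℝ} {N : ℕ} (hmono : Monotone b)
    (hlt : ∀ i < N, b i < b (i + 1)) (hb0 : 0 ≤ b 0) (hb1 : b N ≤ 1) {τ : ℝ} (hτ : 0 < τ) :
    ∃ z : C(unitInterval, unitInterval), MeasPres z ∧
      (∀ x : unitInterval, b N ≤ x → z x = x) ∧
      ∀ i < N, (∀ x : unitInterval, (x : ℝ) ∈ Icc (b i) (b (i + 1)) →
          (z x : ℝ) ∈ Icc (b i) (b (i + 1))) ∧
        ∀ s t : ℝ, b i ≤ s → t ≤ b (i + 1) → τ ≤ t - s →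
          ∀ w : unitInterval, (w : ℝ) ∈ Icc (b i) (b (i + 1)) →
            ∃ u : unitInterval, (u : ℝ) ∈ Icc s t ∧ z u = w := by
  induction N with
  | zero => exact ⟨ContinuousMap.id _, fun A _ => rfl, fun x _ => rfl, fun i hi => by omega⟩
  | succ n ih =>
    obtain ⟨z, hz, hzid, hzi⟩ := ih (fun i hi => hlt i (by omega)) ((hmono n.le_succ).trans hb1)
    obtain ⟨y, hy, hyid, hymem, hycov⟩ := exists_measPres_zigzag (hb0.trans (hmono n.zero_le))
      (hlt n n.lt_succ_self) hb1 hτ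
    refine ⟨z.comp y, hz.comp hy, fun x hx => ?_, fun i hi => ?_⟩
    · rw [ContinuousMap.comp_apply, hyid x (Or.inr hx), hzid x ((hmono n.le_succ).trans hx)]
    · rcases Nat.lt_succ_iff_lt_or_eq.1 hi with hi | rfl
      · have hle : b (i + 1) ≤ b n := hmono hi
        refine ⟨fun x hx => ?_, fun s t hs ht hst w hw => ?_⟩
        · rw [ContinuousMap.comp_apply, hyid x (Or.inl (hx.2.trans hle))]
          exact (hzi i hi).1 x hx
        · obtain ⟨u, hu, huw⟩ := (hzi i hi).2 s t hs ht hst w hw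
          refine ⟨u, hu, ?_⟩
          rw [ContinuousMap.comp_apply, hyid u (Or.inl ((hu.2.trans ht).trans hle)), huw]
      · refine ⟨fun x hx => ?_, fun s t hs ht hst w hw => ?_⟩
        · rw [ContinuousMap.comp_apply, hzid _ (hymem x hx).1]
          exact hymem x hx
        · obtain ⟨u, hu, huw⟩ := hycov s t hs ht hst w hw
          refine ⟨u, hu, ?_⟩
          rw [ContinuousMap.comp_apply, huw, hzid w hw.1]

theorem exists_forall_iterate_mem {X : Type*} [TopologicalSpace X] [CompactSpace X] {g : X → X}
    (hg : Continuous g) {K : ℕ → Set X} (hK : ∀ n, IsClosed (K n)) (hne : ∀ n, (K n).Nonempty)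
    (hcov : ∀ n, K (n + 1) ⊆ g '' K n) : ∃ x, ∀ n, g^[n] x ∈ K n := by
  let t : ℕ → Set X := fun n => ⋂ k ∈ Iic n, g^[k] ⁻¹' K k
  have hsurj : ∀ n, ∀ y ∈ K n, ∃ x ∈ t n, g^[n] x = y := by
    intro n
    induction n with
    | zero => exact fun y hy => ⟨y, by simpa [t] using hy, rfl⟩
    | succ n ih =>
      intro y hy
      obtain ⟨w, hw, rfl⟩ := hcov n hy
      obtain ⟨x, hx, rfl⟩ := ih w hw
      refine ⟨x, ?_, Function.iterate_succ_apply' g n x⟩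
      simp only [t, mem_iInter, mem_Iic, mem_preimage] at hx ⊢
      intro k hk
      rcases Nat.le_succ_iff.1 hk with hk | rfl
      · exact hx k hk
      · rwa [Nat.succ_eq_add_one, Function.iterate_succ_apply']
  have hclosed : ∀ n, IsClosed (t n) := fun n =>
    isClosed_biInter fun k _ => (hK k).preimage (hg.iterate k)
  obtain ⟨x, hx⟩ := IsCompact.nonempty_iInter_of_sequence_nonempty_isCompact_isClosed t
    (fun n => biInter_mono (Iic_subset_Iic.2 n.le_succ) fun _ _ => le_rfl)
    (fun n => let ⟨y, hy⟩ := hne n; let ⟨x, hx, _⟩ := hsurj n y hy; ⟨x, hx⟩)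
    (hclosed 0).isCompact hclosed
  refine ⟨x, fun n => ?_⟩
  have := mem_iInter.1 hx n
  simp only [t, mem_iInter] at this
  exact this n self_mem_Iic

theorem exists_mem_Icc_of_partition {b : ℕ → ℝ} {N : ℕ} (hN : 0 < N) {x : ℝ} (h0 : b 0 ≤ x)
    (h1 : x ≤ b N) : ∃ i < N, x ∈ Icc (b i) (b (i + 1)) := by
  induction N, hN using Nat.le_induction with
  | base => exact ⟨0, by norm_num, h0, h1⟩
  | succ n hn ih =>
    rcases le_total x (b n) with hx | hx
    · obtain ⟨i, hi, hxi⟩ := ih hx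
      exact ⟨i, by omega, hxi⟩
    · exact ⟨n, n.lt_succ_self, hx, h1⟩

theorem isCompact_coe_mem_Icc (s t : ℝ) : IsCompact {x : unitInterval | (x : ℝ) ∈ Icc s t} :=
  (isClosed_Icc.preimage continuous_subtype_val).isCompact

theorem isPreconnected_coe_mem_Icc (s t : ℝ) :
    IsPreconnected {x : unitInterval | (x : ℝ) ∈ Icc s t} :=
  OrdConnected.isPreconnected
    ⟨fun _ hx _ hy _ hz => ⟨hx.1.trans (Subtype.coe_le_coe.2 hz.1),
      (Subtype.coe_le_coe.2 hz.2).trans hy.2⟩⟩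

theorem MeasPres.not_const_on_Icc {f : C(unitInterval, unitInterval)} (hf : MeasPres f) {s t : ℝ}
    (hs : 0 ≤ s) (hst : s < t) (ht : t ≤ 1) (c : unitInterval) :
    ¬ ∀ x : unitInterval, (x : ℝ) ∈ Icc s t → f x = c := by
  intro h
  have h1 : lebI (f ⁻¹' {c}) = 0 := by
    rw [hf _ (measurableSet_singleton c), lebI_apply]
    simp
  have h2 : lebI {x : unitInterval | (x : ℝ) ∈ Icc s t} = ENNReal.ofReal (t - s) := by
    rw [lebI_apply, ← Real.volume_Icc]
    congr 1
    ext x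
    exact ⟨fun ⟨y, hy, hyx⟩ => hyx ▸ hy, fun hx => ⟨⟨x, hs.trans hx.1, hx.2.trans ht⟩, hx, rfl⟩⟩
  have h3 := measure_mono_null (s := {x : unitInterval | (x : ℝ) ∈ Icc s t}) h h1
  rw [h2, ENNReal.ofReal_eq_zero] at h3
  linarith

/-- After precomposing `f` with a small zigzag, there is a fine partition whose interior points are
not extreme values of the map on the intervals of the partition. -/
theorem exists_partition_avoiding_extrema (f : C(unitInterval, unitInterval)) {θ : ℝ}
    (hθ : 0 < θ) :
    ∃ z : C(unitInterval, unitInterval), MeasPres z ∧ (∀ x, dist (z x) x ≤ θ) ∧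
      ∃ (N : ℕ) (b : ℕ → ℝ), 0 < N ∧ Monotone b ∧ b 0 = 0 ∧ b N = 1 ∧
        ∀ i < N, b i < b (i + 1) ∧ b (i + 1) ≤ b i + θ ∧
          ∀ x : unitInterval, (x : ℝ) ∈ Icc (b i) (b (i + 1)) →
            ((∀ y : unitInterval, (y : ℝ) ∈ Icc (b i) (b (i + 1)) → f (z y) ≤ f (z x)) ∨
              (∀ y : unitInterval, (y : ℝ) ∈ Icc (b i) (b (i + 1)) → f (z x) ≤ f (z y))) →
            ∀ j, 0 < j → j < N → (f (z x) : ℝ) ≠ b j := by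
  obtain ⟨n, hn⟩ := exists_nat_gt (2 / θ)
  have hnpos : (0 : ℝ) < n := lt_trans (by positivity) hn
  have hn0 : 0 < n := by exact_mod_cast hnpos
  obtain ⟨h, hh⟩ : ∃ h : ℝ, h = 1 / n := ⟨_, rfl⟩
  have hpos : 0 < h := by rw [hh]; positivity
  have hnh : n * h = 1 := by rw [hh]; field_simp
  have hθh : 2 * h ≤ θ := by
    rw [div_lt_iff₀ hθ] at hn
    nlinarith
  set a : ℕ → ℝ := fun i => i * h with ha
  have hasucc : ∀ i, a (i + 1) = a i + h := fun i => by simp only [ha]; push_cast; ring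
  have hamono : Monotone a := monotone_nat_of_le_succ fun i => by rw [hasucc]; linarith
  have ha0 : a 0 = 0 := by simp [ha]
  have han : a n = 1 := hnh
  obtain ⟨z, hz, -, hzi⟩ := exists_measPres_zigzag_partition (N := n) hamono
    (fun i _ => by rw [hasucc]; linarith) ha0.ge han.le (τ := h / 3) (by positivity)
  have hext : ∀ i, i < n → ∃ u v : unitInterval, (u : ℝ) ∈ Icc (a i) (a (i + 1)) ∧
      (v : ℝ) ∈ Icc (a i) (a (i + 1)) ∧
      ∀ x : unitInterval, (x : ℝ) ∈ Icc (a i) (a (i + 1)) → f u ≤ f x ∧ f x ≤ f v := by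
    intro i hi
    have hne : {x : unitInterval | (x : ℝ) ∈ Icc (a i) (a (i + 1))}.Nonempty :=
      ⟨⟨a i, ha0 ▸ hamono i.zero_le, han ▸ hamono hi.le⟩, le_rfl, hamono i.le_succ⟩
    obtain ⟨u, hu, hu'⟩ := (isCompact_coe_mem_Icc _ _).exists_isMinOn hne f.continuous.continuousOn
    obtain ⟨v, hv, hv'⟩ := (isCompact_coe_mem_Icc _ _).exists_isMaxOn hne f.continuous.continuousOn
    exact ⟨u, v, hu, hv, fun x hx => ⟨hu' hx, hv' hx⟩⟩
  choose! u v hu hv huv using hext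
  set E : Set ℝ := (fun i => (f (u i) : ℝ)) '' Iio n ∪ (fun i => (f (v i) : ℝ)) '' Iio n with hE
  have hEfin : E.Finite := ((finite_Iio n).image _).union ((finite_Iio n).image _)
  have hc : ∀ i : ℕ, ∃ c : ℝ, c ∈ Ioo (a i + h / 3) (a i + 2 * h / 3) ∧ c ∉ E := fun i => by
    obtain ⟨c, hc, hcE⟩ := ((Ioo_infinite (a := a i + h / 3) (b := a i + 2 * h / 3)
      (by linarith)).sdiff hEfin).nonempty
    exact ⟨c, hc, hcE⟩
  choose c hc hcE using hc
  have hcle : ∀ i < n, c i < 1 := fun i hi => by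
    have h1 : a (i + 1) ≤ 1 := han ▸ hamono hi
    have h2 := (hc i).2
    rw [hasucc] at h1
    linarith
  let b : ℕ → ℝ := fun i => Nat.casesOn i 0 fun j => if j < n then c j else 1
  have hb0 : b 0 = 0 := rfl
  have hbs : ∀ j < n, b (j + 1) = c j := fun j hj => if_pos hj
  have hbn : ∀ j, n ≤ j → b (j + 1) = 1 := fun j hj => if_neg (by omega)
  have hstep : ∀ i < n + 1, b i < b (i + 1) ∧ b (i + 1) ≤ b i + θ := by
    intro i hi
    rcases i with _ | j
    · have := hc 0
      rw [hb0, hbs 0 hn0]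
      constructor <;> linarith [this.1, this.2]
    · have hj := hc j
      rw [hbs j (by omega)]
      by_cases hjn : j + 1 < n
      · have := hc (j + 1)
        rw [hasucc] at this
        rw [hbs _ hjn]
        constructor <;> linarith [this.1, this.2, hj.1, hj.2]
      · have hjn' : j + 1 = n := by omega
        have h1 := hasucc j
        rw [hjn', han] at h1
        rw [hbn _ (by omega)]
        constructor <;> linarith [hj.1, hj.2]
  have hbmono : Monotone b := monotone_nat_of_le_succ fun i => by
    by_cases hi : i < n + 1
    · exact (hstep i hi).1.le
    · obtain ⟨j, rfl⟩ : ∃ j, i = j + 1 := ⟨i - 1, by omega⟩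
      rw [hbn j (by omega), hbn (j + 1) (by omega)]
  have hloc : ∀ i < n + 1, ∀ x : unitInterval, (x : ℝ) ∈ Icc (b i) (b (i + 1)) →
      ∃ k < n, (x : ℝ) ∈ Icc (a k) (a (k + 1)) ∧ ∃ s t, a k ≤ s ∧ t ≤ a (k + 1) ∧ h / 3 ≤ t - s ∧
        b i ≤ s ∧ t ≤ b (i + 1) := by
    intro i hi x hx
    rcases i with _ | j
    · have h0 := hc 0
      have h1 := hasucc 0
      rw [hb0, hbs 0 hn0] at *
      refine ⟨0, hn0, ⟨?_, ?_⟩, 0, c 0, ?_, ?_, ?_, le_rfl, le_rfl⟩ <;>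
        linarith [hx.1, hx.2, h0.1, h0.2]
    · have hjn : j < n := by omega
      have h0 := hc j
      have h1 := hasucc j
      rw [hbs j hjn] at *
      rcases le_or_gt (x : ℝ) (a (j + 1)) with hxa | hxa
      · refine ⟨j, hjn, ⟨?_, hxa⟩, c j, a (j + 1), ?_, le_rfl, ?_, le_rfl, ?_⟩
        any_goals linarith [hx.1, h0.1, h0.2]
        by_cases hj' : j + 1 < n
        · rw [hbs _ hj']
          linarith [(hc (j + 1)).1]
        · rw [hbn _ (by omega), ← han]
          exact hamono hjn
      · have hj' : j + 1 < n := by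
          by_contra hcon
          have : j + 1 = n := by omega
          rw [this, han] at hxa
          linarith [x.2.2]
        have h2 := hc (j + 1)
        have h3 := hasucc (j + 1)
        rw [hbs _ hj'] at *
        refine ⟨j + 1, hj', ⟨hxa.le, ?_⟩, a (j + 1), c (j + 1), le_rfl, ?_, ?_, ?_, le_rfl⟩ <;>
          linarith [hx.1, hx.2, h2.1, h2.2, h0.1, h0.2]
  refine ⟨z, hz, fun x => ?_, n + 1, b, by omega, hbmono, hb0, hbn n le_rfl, fun i hi =>
    ⟨(hstep i hi).1, (hstep i hi).2, fun x hx hmm j hj0 hjn => ?_⟩⟩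
  · obtain ⟨i, hi, hx⟩ := exists_mem_Icc_of_partition hn0 (ha0.le.trans x.2.1)
      (x.2.2.trans han.ge)
    have hzx := (hzi i hi).1 x hx
    rw [hasucc] at hx hzx
    rw [Subtype.dist_eq, Real.dist_eq, abs_le]
    constructor <;> linarith [hx.1, hx.2, hzx.1, hzx.2]
  · obtain ⟨k, hk, hxk, s, t, hs, ht, hst, hbs', hbt⟩ := hloc i hi x hx
    have hmem : (f (z x) : ℝ) ∈ E := by
      have hzx := (hzi k hk).1 x hxk
      rcases hmm with hmax | hmin
      · obtain ⟨y, hy, hyv⟩ := (hzi k hk).2 s t hs ht hst (v k) (hv k hk)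
        refine Or.inr ⟨k, hk, congrArg Subtype.val (le_antisymm ?_ (huv k hk _ hzx).2)⟩
        rw [← hyv]
        exact hmax y ⟨hbs'.trans hy.1, hy.2.trans hbt⟩
      · obtain ⟨y, hy, hyv⟩ := (hzi k hk).2 s t hs ht hst (u k) (hu k hk)
        refine Or.inl ⟨k, hk, congrArg Subtype.val (le_antisymm (huv k hk _ hzx).1 ?_)⟩
        rw [← hyv]
        exact hmin y ⟨hbs'.trans hy.1, hy.2.trans hbt⟩
    obtain ⟨l, rfl⟩ : ∃ l, j = l + 1 := ⟨j - 1, by omega⟩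
    rw [hbs l (by omega)]
    exact fun heq => hcE l (heq ▸ hmem)

/-- Every measure-preserving map can be perturbed to a measure-preserving map `F` such that all
pseudo orbits of maps close to `F` are `ε`-traced. -/
theorem exists_robust_tracing {f : C(unitInterval, unitInterval)} (hf : MeasPres f) {η ε : ℝ}
    (hη : 0 < η) (hε : 0 < ε) :
    ∃ F : C(unitInterval, unitInterval), MeasPres F ∧ dist F f < η ∧ ∃ r > 0,
      ∀ g : C(unitInterval, unitInterval), dist g F < r → ∀ y : ℕ → unitInterval,
        IsPseudoOrbit g r y → ∃ x : unitInterval, Traces g ε x y := by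
  obtain ⟨θ₀, hθ₀, hfθ⟩ := Metric.uniformContinuous_iff.1
    (CompactSpace.uniformContinuous_of_continuous f.continuous) η hη
  obtain ⟨θ, hθ, hθ1, hθ2⟩ : ∃ θ : ℝ, 0 < θ ∧ 2 * θ < θ₀ ∧ θ < ε :=
    ⟨min (θ₀ / 3) (ε / 2), by positivity, by linarith [min_le_left (θ₀ / 3) (ε / 2)],
      by linarith [min_le_right (θ₀ / 3) (ε / 2)]⟩
  obtain ⟨z₁, hz₁, hz₁d, N, b, hN, hbmono, hb0, hbN, hb⟩ :=
    exists_partition_avoiding_extrema f hθ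
  have hb01 : ∀ i ≤ N, b i ∈ Icc (0 : ℝ) 1 := fun i hi =>
    ⟨hb0 ▸ hbmono i.zero_le, hbN ▸ hbmono hi⟩
  have hext : ∀ i, i < N → ∃ u v : unitInterval, (u : ℝ) ∈ Icc (b i) (b (i + 1)) ∧
      (v : ℝ) ∈ Icc (b i) (b (i + 1)) ∧
      ∀ x : unitInterval, (x : ℝ) ∈ Icc (b i) (b (i + 1)) →
        f (z₁ u) ≤ f (z₁ x) ∧ f (z₁ x) ≤ f (z₁ v) := by
    intro i hi
    have hne : {x : unitInterval | (x : ℝ) ∈ Icc (b i) (b (i + 1))}.Nonempty :=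
      ⟨⟨b i, hb01 i hi.le⟩, le_rfl, hbmono i.le_succ⟩
    obtain ⟨u, hu, hu'⟩ := (isCompact_coe_mem_Icc _ _).exists_isMinOn hne
      (f.comp z₁).continuous.continuousOn
    obtain ⟨v, hv, hv'⟩ := (isCompact_coe_mem_Icc _ _).exists_isMaxOn hne
      (f.comp z₁).continuous.continuousOn
    exact ⟨u, v, hu, hv, fun x hx => ⟨hu' hx, hv' hx⟩⟩
  choose! u v hu hv huv using hext
  set c : ℕ → ℝ := fun i => f (z₁ (u i)) with hc
  set d : ℕ → ℝ := fun i => f (z₁ (v i)) with hd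
  have hcd : ∀ i < N, c i < d i := by
    intro i hi
    refine lt_of_le_of_ne (huv i hi _ (hv i hi)).1 fun heq => ?_
    refine (hf.comp hz₁).not_const_on_Icc (hb01 i hi.le).1 (hb i hi).1 (hb01 (i + 1) hi).2
      (f (z₁ (u i))) fun x hx => le_antisymm ?_ (huv i hi x hx).1
    exact (huv i hi x hx).2.trans (Subtype.coe_le_coe.1 heq.ge)
  have hbd : ∀ i < N, ∀ j < N, b j ≠ d i := by
    intro i hi j hj
    rcases j.eq_zero_or_pos with rfl | hj0
    · rw [hb0]
      exact ((f (z₁ (u i))).2.1.trans_lt (hcd i hi)).ne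
    · exact ((hb i hi).2.2 _ (hv i hi) (Or.inl fun y hy => (huv i hi y hy).2) j hj0 hj).symm
  have hbc : ∀ i < N, ∀ j < N, b (j + 1) ≠ c i := by
    intro i hi j hj
    rcases (show j + 1 ≤ N from hj).eq_or_lt with hj' | hj'
    · rw [hj', hbN]
      exact ((hcd i hi).trans_le (f (z₁ (v i))).2.2).ne'
    · exact ((hb i hi).2.2 _ (hu i hi) (Or.inr fun y hy => (huv i hi y hy).1) _ j.succ_pos hj').symm
  have hev : ∀ᶠ ρ in 𝓝[>] (0 : ℝ), ∀ i ∈ Iio N, ∀ j ∈ Iio N, ρ < |b j - d i| ∧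
      ρ < |b (j + 1) - c i| ∧ ρ < b (j + 1) - b j ∧ ρ < d i - c i := by
    have hlt : ∀ {x : ℝ}, 0 < x → ∀ᶠ ρ in 𝓝[>] (0 : ℝ), ρ < x := fun hx =>
      mem_of_superset (Ioo_mem_nhdsGT hx) fun _ h => h.2
    refine (eventually_all_finite (finite_Iio N)).2 fun i hi =>
      (eventually_all_finite (finite_Iio N)).2 fun j hj => ?_
    exact (hlt (abs_pos.2 (sub_ne_zero.2 (hbd i hi j hj)))).and
      ((hlt (abs_pos.2 (sub_ne_zero.2 (hbc i hi j hj)))).and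
        ((hlt (sub_pos.2 (hb j hj).1)).and (hlt (sub_pos.2 (hcd i hi)))))
  obtain ⟨ρ, hρ, hρpos⟩ := (hev.and self_mem_nhdsWithin).exists
  replace hρpos : 0 < ρ := hρpos
  obtain ⟨z₂, hz₂, -, hz₂i⟩ := exists_measPres_zigzag_partition hbmono (fun i hi => (hb i hi).1)
    hb0.ge hbN.le (τ := ρ / 2) (by positivity)
  have hpart : ∀ x : unitInterval, ∃ i < N, (x : ℝ) ∈ Icc (b i) (b (i + 1)) := fun x =>
    exists_mem_Icc_of_partition hN (hb0.le.trans x.2.1) (x.2.2.trans hbN.ge)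
  have hclose : ∀ i < N, ∀ x y : unitInterval, (x : ℝ) ∈ Icc (b i) (b (i + 1)) →
      (y : ℝ) ∈ Icc (b i) (b (i + 1)) → dist x y ≤ θ := by
    intro i hi x y hx hy
    rw [Subtype.dist_eq, Real.dist_eq, abs_le]
    have := (hb i hi).2.1
    constructor <;> linarith [hx.1, hx.2, hy.1, hy.2]
  refine ⟨(f.comp z₁).comp z₂, (hf.comp hz₁).comp hz₂, ?_, ρ / 4, by positivity, ?_⟩
  · rw [ContinuousMap.dist_lt_iff hη]
    intro x
    apply hfθ
    obtain ⟨i, hi, hx⟩ := hpart x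
    have h1 := hz₁d (z₂ x)
    have h2 := hclose i hi _ _ ((hz₂i i hi).1 x hx) hx
    linarith [dist_triangle (z₁ (z₂ x)) (z₂ x) x]
  intro g hg y hy
  have hgF : ∀ x, |(g x : ℝ) - f (z₁ (z₂ x))| < ρ / 4 := fun x =>
    (ContinuousMap.dist_apply_le_dist (f := g) (g := (f.comp z₁).comp z₂) x).trans_lt hg
  choose i hiN hyi using fun n => hpart (y n)
  let S : ℕ → ℝ := fun n =>
    Nat.casesOn n (b (i 0)) fun n => max (b (i (n + 1))) (c (i n) + ρ / 4)
  let T : ℕ → ℝ := fun n =>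
    Nat.casesOn n (b (i 0 + 1)) fun n => min (b (i (n + 1) + 1)) (d (i n) - ρ / 4)
  have hS : ∀ n, b (i n) ≤ S n := by
    rintro (_ | n)
    exacts [le_rfl, le_max_left _ _]
  have hT : ∀ n, T n ≤ b (i n + 1) := by
    rintro (_ | n)
    exacts [le_rfl, min_le_left _ _]
  have hST : ∀ n, ρ / 2 ≤ T n - S n := by
    rintro (_ | n)
    · have := (hρ _ (hiN 0) _ (hiN 0)).2.2.1
      change ρ / 2 ≤ b (i 0 + 1) - b (i 0)
      linarith
    · obtain ⟨h1, h2, h3, h4⟩ := hρ _ (hiN n) _ (hiN (n + 1))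
      have hyn := hyi (n + 1)
      have hps : |(g (y n) : ℝ) - y (n + 1)| < ρ / 4 := hy n
      have hgn := hgF (y n)
      have hFn := huv _ (hiN n) _ ((hz₂i _ (hiN n)).1 _ (hyi n))
      have hFc : c (i n) ≤ f (z₁ (z₂ (y n))) := hFn.1
      have hFd : (f (z₁ (z₂ (y n))) : ℝ) ≤ d (i n) := hFn.2
      rw [abs_lt] at hps hgn
      have h5 : b (i (n + 1)) < d (i n) - ρ := by
        rcases lt_abs.1 h1 with h | h <;> linarith [hyn.1]
      have h6 : c (i n) + ρ < b (i (n + 1) + 1) := by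
        rcases lt_abs.1 h2 with h | h <;> linarith [hyn.2]
      change ρ / 2 ≤ min (b (i (n + 1) + 1)) (d (i n) - ρ / 4) -
        max (b (i (n + 1))) (c (i n) + ρ / 4)
      rcases min_choice (b (i (n + 1) + 1)) (d (i n) - ρ / 4) with h | h <;>
        rcases max_choice (b (i (n + 1))) (c (i n) + ρ / 4) with h' | h' <;>
          rw [h, h'] <;> linarith
  obtain ⟨x, hx⟩ := exists_forall_iterate_mem g.continuous
    (K := fun n => {x : unitInterval | (x : ℝ) ∈ Icc (S n) (T n)})
    (fun n => (isCompact_coe_mem_Icc _ _).isClosed)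
    (fun n => ⟨⟨S n, (hb01 _ (hiN n).le).1.trans (hS n), by
      linarith [hST n, hT n, (hb01 (i n + 1) (hiN n)).2]⟩, le_rfl, by
        change S n ≤ T n
        linarith [hST n]⟩) fun n w hw => by
      obtain ⟨p, hp, hpu⟩ := (hz₂i _ (hiN n)).2 _ _ (hS n) (hT n) (hST n) _ (hu _ (hiN n))
      obtain ⟨q, hq, hqv⟩ := (hz₂i _ (hiN n)).2 _ _ (hS n) (hT n) (hST n) _ (hv _ (hiN n))
      refine (isPreconnected_coe_mem_Icc (S n) (T n)).intermediate_value hp hq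
        g.continuous.continuousOn ⟨?_, ?_⟩
      · have h1 := abs_lt.1 (hgF p)
        rw [hpu] at h1
        have h2 : c (i n) + ρ / 4 ≤ w := (le_max_right _ _).trans hw.1
        exact Subtype.coe_le_coe.1 (by linarith [h1.2])
      · have h1 := abs_lt.1 (hgF q)
        rw [hqv] at h1
        have h2 : (w : ℝ) ≤ d (i n) - ρ / 4 := hw.2.trans (min_le_right _ _)
        exact Subtype.coe_le_coe.1 (by linarith [h1.1])
  exact ⟨x, fun n => (hclose _ (hiN n) _ _ ⟨(hS n).trans (hx n).1, (hx n).2.trans (hT n)⟩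
    (hyi n)).trans_lt hθ2⟩

theorem shadowing_generic :
    ∃ R : Set ↥CLam, R ∈ residual ↥CLam ∧ ∀ f ∈ R, Shadowing (⇑f.1) := by
  let U : ℕ → Set ↥CLam := fun n => interior {f | ∃ δ > (0 : ℝ), ∀ y : ℕ → unitInterval,
    IsPseudoOrbit f.1 δ y → ∃ x : unitInterval, Traces f.1 (1 / (n + 1)) x y}
  refine ⟨⋂ n, U n, countable_iInter_mem.2 fun n => residual_of_dense_open isOpen_interior ?_,
    fun f hf ε hε => ?_⟩
  · rw [Metric.dense_iff]
    intro f η hη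
    obtain ⟨F, hF, hFf, r, hr, htr⟩ := exists_robust_tracing f.2 hη
      (ε := 1 / ((n : ℝ) + 1)) (by positivity)
    refine ⟨⟨F, hF⟩, hFf, mem_interior_iff_mem_nhds.2 ?_⟩
    exact mem_of_superset (Metric.ball_mem_nhds _ hr) fun g hg => ⟨r, hr, htr g.1 hg⟩
  · obtain ⟨n, hn⟩ := exists_nat_one_div_lt hε
    obtain ⟨δ, hδ, h⟩ := interior_subset (mem_iInter.1 hf n)
    refine ⟨δ, hδ, fun y hy => ?_⟩
    obtain ⟨x, hx⟩ := h y hy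
    exact ⟨x, fun k => (hx k).trans hn⟩
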